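/- Let Ω ⊂ ℝ^d be a Borel set, let 1 < p < ∞, let T_n, T : Ω → ℝ^d be Borel maps that are uniformly bounded (there is C > 0 with |T_n(x)| ≤ C and |T(x)| ≤ C for all n and x), and let ρ_n, ρ be nonnegative functions in L¹(Ω) such that: (i) ρ_n → ρ in L¹(Ω); (ii) the vector-valued measures ρ_n T_n dx converge weakly to ρ T dx, i.e. ∫_Ω f(x) T_n(x) ρ_n(x) dx → ∫_Ω f(x) T(x) ρ(x) dx for every bounded continuous scalar function f on Ω; (iii) ∫_Ω |T_n|^p ρ_n dx → ∫_Ω |T|^p ρ dx. Then T_n → T strongly in L^p(Ω, ρ dx), i.e. ∫_Ω |T_n − T|^p ρ dx → 0. -/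

import Mathlib

open MeasureTheory Filter Topology

open scoped RealInnerProductSpace BoundedContinuousFunction

/-- The gradient inequality for the strictly convex function `‖·‖ ^ p`. -/
theorem fderiv_norm_rpow_sub_lt {E : Type*} [NormedAddCommGroup E] [InnerProductSpace ℝ E]
    {p : ℝ} (hp : 1 < p) {x y : E} (hxy : x ≠ y) :
    fderiv ℝ (fun z : E => ‖z‖ ^ p) x (y - x) < ‖y‖ ^ p - ‖x‖ ^ p := by
  rw [fderiv_norm_rpow x hp]
  simp only [smul_apply, innerSL_apply_apply, inner_sub_right,
    real_inner_self_eq_norm_sq, smul_eq_mul]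
  rcases eq_or_ne x 0 with rfl | hx
  · have hy : 0 < ‖y‖ := norm_pos_iff.2 hxy.symm
    have := Real.rpow_pos_of_pos hy p
    simpa [Real.zero_rpow (by linarith : p ≠ 0)] using this
  have ha : 0 < ‖x‖ := norm_pos_iff.2 hx
  have hap : 0 < ‖x‖ ^ p := Real.rpow_pos_of_pos ha p
  have hb : 0 ≤ ‖y‖ / ‖x‖ := by positivity
  have hyp : ‖y‖ ^ p = ‖x‖ ^ p * (‖y‖ / ‖x‖) ^ p := by
    rw [← Real.mul_rpow ha.le hb, mul_div_cancel₀ _ ha.ne']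
  have hlhs : p * ‖x‖ ^ (p - 2) * (⟪x, y⟫ - ‖x‖ ^ 2) =
      ‖x‖ ^ p * (p * (⟪x, y⟫ / ‖x‖ ^ 2 - 1)) := by
    rw [Real.rpow_sub ha, Real.rpow_two]
    field_simp
  rw [hlhs, hyp, ← mul_sub_one]
  refine mul_lt_mul_of_pos_left ?_ hap
  have hdiv : ‖x‖ * ‖y‖ / ‖x‖ ^ 2 = ‖y‖ / ‖x‖ := by field_simp
  by_cases hn : ‖y‖ = ‖x‖
  · have hlt : ⟪x, y⟫ < ‖x‖ * ‖y‖ := by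
      rw [inner_lt_norm_mul_iff_real, hn]
      exact fun h => hxy (smul_right_injective E ha.ne' h)
    have := (div_lt_div_iff_of_pos_right (pow_pos ha 2)).2 hlt
    rw [hdiv, hn, div_self ha.ne'] at this
    rw [hn, div_self ha.ne', Real.one_rpow]
    nlinarith
  · have hle := div_le_div_of_nonneg_right (real_inner_le_norm x y) (pow_pos ha 2).le
    rw [hdiv] at hle
    have hs : ‖y‖ / ‖x‖ - 1 ≠ 0 := by
      rw [sub_ne_zero]
      exact fun h => hn ((div_eq_one_iff_eq ha.ne').1 h)
    have hB := one_add_mul_self_lt_rpow_one_add (by linarith : -1 ≤ ‖y‖ / ‖x‖ - 1) hs hp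
    rw [add_sub_cancel] at hB
    nlinarith

/-- On balls, `‖y - x‖ ^ p` is controlled by the Bregman divergence of `‖·‖ ^ p`, up to an
arbitrarily small error. -/
theorem exists_norm_sub_rpow_le_add_mul_bregman {E : Type*} [NormedAddCommGroup E]
    [InnerProductSpace ℝ E] [FiniteDimensional ℝ E] {p : ℝ} (hp : 1 < p) (C : ℝ) {ε : ℝ}
    (hε : 0 < ε) :
    ∃ K : ℝ, ∀ x y : E, ‖x‖ ≤ C → ‖y‖ ≤ C →
      ‖y - x‖ ^ p ≤
        ε + K * (‖y‖ ^ p - ‖x‖ ^ p - fderiv ℝ (fun z : E => ‖z‖ ^ p) x (y - x)) := by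
  have hp0 : 0 < p := by linarith
  have hφ : Continuous fun z : E => ‖z‖ ^ p :=
    continuous_norm.rpow_const fun _ => Or.inr hp0.le
  have hφ' : Continuous (fderiv ℝ fun z : E => ‖z‖ ^ p) :=
    (contDiff_norm_rpow hp).continuous_fderiv one_ne_zero
  have hsub : Continuous fun z : E × E => ‖z.2 - z.1‖ ^ p :=
    hφ.comp (continuous_snd.sub continuous_fst)
  have hD : Continuous fun z : E × E =>
      ‖z.2‖ ^ p - ‖z.1‖ ^ p - fderiv ℝ (fun w : E => ‖w‖ ^ p) z.1 (z.2 - z.1) :=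
    ((hφ.comp continuous_snd).sub (hφ.comp continuous_fst)).sub
      ((hφ'.comp continuous_fst).clm_apply (continuous_snd.sub continuous_fst))
  have hcompact : IsCompact ((Metric.closedBall (0 : E) C ×ˢ Metric.closedBall (0 : E) C) ∩
      {z : E × E | ε ≤ ‖z.2 - z.1‖ ^ p}) :=
    ((isCompact_closedBall 0 C).prod (isCompact_closedBall 0 C)).inter_right
      (isClosed_le continuous_const hsub)
  have hpos : ∀ x y : E, x ≠ y →
      0 < ‖y‖ ^ p - ‖x‖ ^ p - fderiv ℝ (fun z : E => ‖z‖ ^ p) x (y - x) :=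
    fun x y h => sub_pos.2 (fderiv_norm_rpow_sub_lt hp h)
  have hne : ∀ x y : E, ε ≤ ‖y - x‖ ^ p → x ≠ y := by
    rintro x y h rfl
    rw [sub_self, norm_zero, Real.zero_rpow hp0.ne'] at h
    linarith
  obtain ⟨K, hK⟩ := hcompact.exists_bound_of_continuousOn
    (hsub.continuousOn.div hD.continuousOn fun z hz => (hpos _ _ (hne _ _ hz.2)).ne')
  refine ⟨max K 0, fun x y hx hy => ?_⟩
  rcases le_total ε (‖y - x‖ ^ p) with h | h
  · have hd := hpos x y (hne x y h)
    have := (le_abs_self _).trans (hK (x, y) ⟨⟨by simpa using hx, by simpa using hy⟩, h⟩)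
    rw [Pi.div_apply, div_le_iff₀ hd] at this
    have := mul_le_mul_of_nonneg_right (le_max_left K 0) hd.le
    linarith
  · rcases eq_or_ne x y with rfl | hxy
    · simpa using h
    · have := mul_nonneg (le_max_right K 0) (hpos x y hxy).le
      linarith

section Weak

variable {X : Type*} [TopologicalSpace X] [NormalSpace X] [MeasurableSpace X] [BorelSpace X]
  {μ : Measure X} [μ.WeaklyRegular]
  {E : Type*} [NormedAddCommGroup E] [NormedSpace ℝ E]
  {u : ℕ → X → E} {v : X → E} {C : ℝ}

/-- For bounded sequences, weak convergence against bounded continuous functions upgrades to weak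
convergence against integrable functions. -/
theorem tendsto_integral_smul_of_forall_boundedContinuous
    (hu : ∀ n, AEStronglyMeasurable (u n) μ) (hv : AEStronglyMeasurable v μ)
    (huC : ∀ n, ∀ᵐ x ∂μ, ‖u n x‖ ≤ C) (hvC : ∀ᵐ x ∂μ, ‖v x‖ ≤ C)
    (hweak : ∀ f : X →ᵇ ℝ, Tendsto (fun n => ∫ x, f x • u n x ∂μ) atTop (𝓝 (∫ x, f x • v x ∂μ)))
    {g : X → ℝ} (hg : Integrable g μ) :
    Tendsto (fun n => ∫ x, g x • u n x ∂μ) atTop (𝓝 (∫ x, g x • v x ∂μ)) := by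
  rw [Metric.tendsto_atTop]
  intro ε hε
  have hM : 0 < |C| + 1 := by positivity
  obtain ⟨f, hfg, hf⟩ := hg.exists_boundedContinuous_integral_sub_le
    (ε := ε / (4 * (|C| + 1))) (by positivity)
  have key : ∀ w : X → E, AEStronglyMeasurable w μ → (∀ᵐ x ∂μ, ‖w x‖ ≤ C) →
      dist (∫ x, g x • w x ∂μ) (∫ x, f x • w x ∂μ) ≤ ε / 4 := by
    intro w hw hwC
    have hwint : ∀ h : X → ℝ, Integrable h μ → Integrable (fun x => h x • w x) μ :=
      fun h hh => hh.smul_bdd C hw hwC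
    rw [dist_eq_norm, ← integral_sub (hwint g hg) (hwint f hf)]
    calc ‖∫ x, g x • w x - f x • w x ∂μ‖
        ≤ ∫ x, ‖g x - f x‖ * (|C| + 1) ∂μ := by
          refine norm_integral_le_of_norm_le ((hg.sub hf).norm.mul_const _) ?_
          filter_upwards [hwC] with x hx
          rw [← sub_smul, norm_smul]
          gcongr
          linarith [le_abs_self C]
      _ = (∫ x, ‖g x - f x‖ ∂μ) * (|C| + 1) := integral_mul_const _ _
      _ ≤ ε / (4 * (|C| + 1)) * (|C| + 1) := by gcongr
      _ = ε / 4 := by field_simp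
  obtain ⟨N, hN⟩ := Metric.tendsto_atTop.1 (hweak f) (ε / 4) (by positivity)
  refine ⟨N, fun n hn => ?_⟩
  have h1 := key (u n) (hu n) (huC n)
  have h2 := key v hv hvC
  have h3 := hN n hn
  have h4 := dist_triangle4 (∫ x, g x • u n x ∂μ) (∫ x, f x • u n x ∂μ) (∫ x, f x • v x ∂μ)
    (∫ x, g x • v x ∂μ)
  rw [dist_comm] at h2
  linarith

/-- The dual pairing version of `tendsto_integral_smul_of_forall_boundedContinuous`. -/
theorem tendsto_integral_dual_apply_of_forall_boundedContinuous [FiniteDimensional ℝ E]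
    (hu : ∀ n, AEStronglyMeasurable (u n) μ) (hv : AEStronglyMeasurable v μ)
    (huC : ∀ n, ∀ᵐ x ∂μ, ‖u n x‖ ≤ C) (hvC : ∀ᵐ x ∂μ, ‖v x‖ ≤ C)
    (hweak : ∀ f : X →ᵇ ℝ, Tendsto (fun n => ∫ x, f x • u n x ∂μ) atTop (𝓝 (∫ x, f x • v x ∂μ)))
    {g : X → E →L[ℝ] ℝ} (hg : Integrable g μ) :
    Tendsto (fun n => ∫ x, g x (u n x) ∂μ) atTop (𝓝 (∫ x, g x (v x) ∂μ)) := by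
  have := FiniteDimensional.complete ℝ E
  let b := Module.finBasis ℝ E
  have hgb : ∀ i, Integrable (fun x => g x (b i)) μ :=
    fun i => (ContinuousLinearMap.apply ℝ ℝ (b i)).integrable_comp hg
  have key : ∀ w : X → E, AEStronglyMeasurable w μ → (∀ᵐ x ∂μ, ‖w x‖ ≤ C) →
      ∫ x, g x (w x) ∂μ =
        ∑ i, LinearMap.toContinuousLinearMap (b.coord i) (∫ x, g x (b i) • w x ∂μ) := by
    intro w hw hwC
    have hwint : ∀ i, Integrable (fun x => g x (b i) • w x) μ :=
      fun i => (hgb i).smul_bdd C hw hwC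
    simp_rw [← fun i => ContinuousLinearMap.integral_comp_comm
      (LinearMap.toContinuousLinearMap (b.coord i)) (hwint i)]
    rw [← integral_finsetSum _ fun i _ => ContinuousLinearMap.integrable_comp _ (hwint i)]
    refine integral_congr_ae (.of_forall fun x => ?_)
    dsimp only
    conv_lhs => rw [← b.sum_repr (w x), map_sum]
    simp only [map_smul, smul_eq_mul, LinearMap.coe_toContinuousLinearMap',
      Module.Basis.coord_apply, mul_comm]
  rw [key v hv hvC]
  simp_rw [fun n => key (u n) (hu n) (huC n)]
  exact tendsto_finsetSum _ fun i _ => (ContinuousLinearMap.continuous _).tendsto _ |>.comp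
    (tendsto_integral_smul_of_forall_boundedContinuous hu hv huC hvC hweak (hgb i))

end Weak

theorem integrable_continuous_comp_of_ae_norm_le {X E F : Type*} [MeasurableSpace X]
    {μ : Measure X} [IsFiniteMeasure μ] [NormedAddCommGroup E] [ProperSpace E]
    [NormedAddCommGroup F] {ψ : E → F} {w : X → E} {C : ℝ} (hψ : Continuous ψ)
    (hw : AEStronglyMeasurable w μ) (hwC : ∀ᵐ x ∂μ, ‖w x‖ ≤ C) :
    Integrable (fun x => ψ (w x)) μ := by
  obtain ⟨B, hB⟩ := (isCompact_closedBall (0 : E) C).exists_bound_of_continuousOn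
    hψ.continuousOn
  refine .of_bound (hψ.comp_aestronglyMeasurable hw) B ?_
  filter_upwards [hwC] with x hx using hB _ (by simpa using hx)

/-- Radon–Riesz property for bounded sequences: weak convergence and convergence of the
`p`-th moments imply strong `L^p` convergence. -/
theorem tendsto_integral_norm_sub_rpow_of_weak
    {X : Type*} [TopologicalSpace X] [NormalSpace X] [MeasurableSpace X] [BorelSpace X]
    {μ : Measure X} [IsFiniteMeasure μ] [μ.WeaklyRegular]
    {E : Type*} [NormedAddCommGroup E] [InnerProductSpace ℝ E] [FiniteDimensional ℝ E]
    {u : ℕ → X → E} {v : X → E} {C p : ℝ} (hp : 1 < p)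
    (hu : ∀ n, AEStronglyMeasurable (u n) μ) (hv : AEStronglyMeasurable v μ)
    (huC : ∀ n, ∀ᵐ x ∂μ, ‖u n x‖ ≤ C) (hvC : ∀ᵐ x ∂μ, ‖v x‖ ≤ C)
    (hweak : ∀ f : X →ᵇ ℝ, Tendsto (fun n => ∫ x, f x • u n x ∂μ) atTop (𝓝 (∫ x, f x • v x ∂μ)))
    (hmom : Tendsto (fun n => ∫ x, ‖u n x‖ ^ p ∂μ) atTop (𝓝 (∫ x, ‖v x‖ ^ p ∂μ))) :
    Tendsto (fun n => ∫ x, ‖u n x - v x‖ ^ p ∂μ) atTop (𝓝 0) := by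
  have hp0 : 0 < p := by linarith
  have hφ : Continuous fun z : E => ‖z‖ ^ p :=
    continuous_norm.rpow_const fun _ => Or.inr hp0.le
  have hφ' : Continuous (fderiv ℝ fun z : E => ‖z‖ ^ p) :=
    (contDiff_norm_rpow hp).continuous_fderiv one_ne_zero
  have hg : Integrable (fun x => fderiv ℝ (fun z : E => ‖z‖ ^ p) (v x)) μ :=
    integrable_continuous_comp_of_ae_norm_le hφ' hv hvC
  have hgint : ∀ w : X → E, AEStronglyMeasurable w μ → (∀ᵐ x ∂μ, ‖w x‖ ≤ C) →
      Integrable (fun x => fderiv ℝ (fun z : E => ‖z‖ ^ p) (v x) (w x)) μ := by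
    intro w hw hwC
    refine (hg.norm.mul_const C).mono'
      (isBoundedBilinearMap_apply.continuous.comp_aestronglyMeasurable
        (hg.aestronglyMeasurable.prodMk hw)) ?_
    filter_upwards [hwC] with x hx
    exact (ContinuousLinearMap.le_opNorm _ _).trans (by gcongr)
  have hIu : ∀ n, Integrable (fun x => ‖u n x‖ ^ p) μ :=
    fun n => integrable_continuous_comp_of_ae_norm_le hφ (hu n) (huC n)
  have hIv : Integrable (fun x => ‖v x‖ ^ p) μ :=
    integrable_continuous_comp_of_ae_norm_le hφ hv hvC
  have hIuv : ∀ n, Integrable (fun x => ‖u n x‖ ^ p - ‖v x‖ ^ p) μ := fun n => (hIu n).sub hIv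
  have hgu : ∀ n, Integrable (fun x => fderiv ℝ (fun z : E => ‖z‖ ^ p) (v x) (u n x) -
      fderiv ℝ (fun z : E => ‖z‖ ^ p) (v x) (v x)) μ :=
    fun n => (hgint _ (hu n) (huC n)).sub (hgint _ hv hvC)
  have hdual := tendsto_integral_dual_apply_of_forall_boundedContinuous hu hv huC hvC hweak hg
  have hDint : ∀ n, Integrable (fun x => ‖u n x‖ ^ p - ‖v x‖ ^ p -
      fderiv ℝ (fun z : E => ‖z‖ ^ p) (v x) (u n x - v x)) μ := by
    intro n
    simp_rw [map_sub]
    exact (hIuv n).sub (hgu n)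
  have hD : Tendsto (fun n => ∫ x, (‖u n x‖ ^ p - ‖v x‖ ^ p -
      fderiv ℝ (fun z : E => ‖z‖ ^ p) (v x) (u n x - v x)) ∂μ) atTop (𝓝 0) := by
    have hlim := (hmom.sub_const (∫ x, ‖v x‖ ^ p ∂μ)).sub
      (hdual.sub_const (∫ x, fderiv ℝ (fun z : E => ‖z‖ ^ p) (v x) (v x) ∂μ))
    rw [sub_self, sub_self, sub_zero] at hlim
    refine hlim.congr fun n => ?_
    simp_rw [map_sub]
    rw [integral_sub (hIuv n) (hgu n), integral_sub (hIu n) hIv,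
      integral_sub (hgint _ (hu n) (huC n)) (hgint _ hv hvC)]
  have hnn : ∀ n, 0 ≤ ∫ x, ‖u n x - v x‖ ^ p ∂μ := fun n => integral_nonneg fun x => by positivity
  rw [Metric.tendsto_atTop]
  intro ε hε
  have hm : 0 ≤ μ.real Set.univ := measureReal_nonneg
  obtain ⟨K, hK⟩ := exists_norm_sub_rpow_le_add_mul_bregman (E := E) hp C
    (ε := ε / (2 * (μ.real Set.univ + 1))) (by positivity)
  have hKD := hD.const_mul K
  rw [mul_zero] at hKD
  obtain ⟨N, hN⟩ := Metric.tendsto_atTop.1 hKD (ε / 2) (by positivity)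
  refine ⟨N, fun n hn => ?_⟩
  rw [Real.dist_0_eq_abs, abs_of_nonneg (hnn n)]
  have hsmall := (le_abs_self _).trans_lt ((Real.dist_0_eq_abs _).symm.trans_lt (hN n hn))
  have hle : ∫ x, ‖u n x - v x‖ ^ p ∂μ ≤ ∫ x, (ε / (2 * (μ.real Set.univ + 1)) +
      K * (‖u n x‖ ^ p - ‖v x‖ ^ p -
        fderiv ℝ (fun z : E => ‖z‖ ^ p) (v x) (u n x - v x))) ∂μ := by
    refine integral_mono_ae (integrable_continuous_comp_of_ae_norm_le (C := C + C) hφ ((hu n).sub hv) ?_)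
      ((integrable_const _).add ((hDint n).const_mul K)) ?_
    · filter_upwards [huC n, hvC] with x h1 h2 using (norm_sub_le _ _).trans (add_le_add h1 h2)
    · filter_upwards [huC n, hvC] with x h1 h2 using hK _ _ h2 h1
  rw [integral_add (integrable_const _) ((hDint n).const_mul K), integral_const,
    integral_const_mul, smul_eq_mul] at hle
  have hconst : μ.real Set.univ * (ε / (2 * (μ.real Set.univ + 1))) ≤ ε / 2 := by
    rw [mul_div_assoc', div_le_div_iff₀ (by positivity) (by positivity)]
    nlinarith
  linarith

/-- If `ρn → ρ` in `L¹`, then densities may be exchanged in limits of integrals of uniformly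
bounded functions. -/
theorem tendsto_integral_smul_of_tendsto_density {X : Type*} [MeasurableSpace X] {ν : Measure X}
    {V : Type*} [NormedAddCommGroup V] [NormedSpace ℝ V] {ρ : X → ℝ} {ρn : ℕ → X → ℝ}
    (hρ : Integrable ρ ν) (hρn : ∀ n, Integrable (ρn n) ν)
    (hL1 : Tendsto (fun n => ∫ x, |ρn n x - ρ x| ∂ν) atTop (𝓝 0))
    {F : ℕ → X → V} {M : ℝ} (hF : ∀ n, AEStronglyMeasurable (F n) ν)
    (hFM : ∀ n, ∀ᵐ x ∂ν, ‖F n x‖ ≤ M) {L : V}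
    (hlim : Tendsto (fun n => ∫ x, ρn n x • F n x ∂ν) atTop (𝓝 L)) :
    Tendsto (fun n => ∫ x, ρ x • F n x ∂ν) atTop (𝓝 L) := by
  have hdiff : Tendsto (fun n => ∫ x, (ρn n x - ρ x) • F n x ∂ν) atTop (𝓝 0) := by
    refine squeeze_zero_norm (fun n => ?_) (by simpa using hL1.mul_const M)
    rw [← integral_mul_const]
    refine norm_integral_le_of_norm_le (((hρn n).sub hρ).abs.mul_const M) ?_
    filter_upwards [hFM n] with x hx
    rw [norm_smul, Real.norm_eq_abs]
    gcongr
  rw [← sub_zero L]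
  refine (hlim.sub hdiff).congr fun n => ?_
  refine (integral_sub ((hρn n).smul_bdd M (hF n) (hFM n))
    (((hρn n).sub hρ).smul_bdd M (hF n) (hFM n))).symm.trans ?_
  exact integral_congr_ae (.of_forall fun x => by simp [sub_smul])

/-- If uniformly bounded Borel maps `T_n, T : Ω → ℝ^d` and nonnegative densities
`ρ_n → ρ` in `L¹(Ω)` satisfy the weak convergence `ρ_n T_n ⇀ ρ T` as vector measures and
the convergence of the `p`-moments `∫ |T_n|^p ρ_n → ∫ |T|^p ρ`, then `T_n → T` strongly
in `L^p(Ω, ρ dx)`. -/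
theorem strong_Lp_convergence_of_transports
    {d : ℕ} (Ω : Set (EuclideanSpace ℝ (Fin d))) (hΩ : MeasurableSet Ω)
    (p : ℝ) (hp : 1 < p)
    (T : EuclideanSpace ℝ (Fin d) → EuclideanSpace ℝ (Fin d))
    (Tn : ℕ → EuclideanSpace ℝ (Fin d) → EuclideanSpace ℝ (Fin d))
    (hTmeas : Measurable T) (hTnmeas : ∀ n, Measurable (Tn n))
    (C : ℝ) (hC : 0 < C)
    (hTbd : ∀ x ∈ Ω, ‖T x‖ ≤ C) (hTnbd : ∀ n, ∀ x ∈ Ω, ‖Tn n x‖ ≤ C)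
    (ρ : EuclideanSpace ℝ (Fin d) → ℝ) (ρn : ℕ → EuclideanSpace ℝ (Fin d) → ℝ)
    (hρmeas : Measurable ρ) (hρnmeas : ∀ n, Measurable (ρn n))
    (hρnn : ∀ x, 0 ≤ ρ x) (hρnnn : ∀ n x, 0 ≤ ρn n x)
    (hρint : IntegrableOn ρ Ω) (hρnint : ∀ n, IntegrableOn (ρn n) Ω)
    -- (i) `ρ_n → ρ` in `L¹(Ω)`
    (hL1 : Tendsto (fun n => ∫ x in Ω, |ρn n x - ρ x|) atTop (𝓝 0))
    -- (ii) `ρ_n T_n dx ⇀ ρ T dx` weakly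
    (hweak : ∀ f : EuclideanSpace ℝ (Fin d) → ℝ,
        ContinuousOn f Ω → (∃ M : ℝ, ∀ x ∈ Ω, |f x| ≤ M) →
        Tendsto (fun n => ∫ x in Ω, (f x * ρn n x) • Tn n x) atTop
          (𝓝 (∫ x in Ω, (f x * ρ x) • T x)))
    -- (iii) convergence of the `p`-moments
    (hmom : Tendsto (fun n => ∫ x in Ω, ‖Tn n x‖ ^ p * ρn n x) atTop
      (𝓝 (∫ x in Ω, ‖T x‖ ^ p * ρ x))) :
    Tendsto (fun n => ∫ x in Ω, ‖Tn n x - T x‖ ^ p * ρ x) atTop (𝓝 0) := by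
  have hΩae : ∀ᵐ x ∂volume.restrict Ω, x ∈ Ω := ae_restrict_mem hΩ
  let μ := (volume.restrict Ω).withDensity fun x => ENNReal.ofReal (ρ x)
  have : IsFiniteMeasure μ := isFiniteMeasure_withDensity_ofReal hρint.hasFiniteIntegral
  have hμae : ∀ᵐ x ∂μ, x ∈ Ω := (withDensity_absolutelyContinuous _ _).ae_le hΩae
  have hμ : ∀ {V : Type} [NormedAddCommGroup V] [NormedSpace ℝ V]
      (F : EuclideanSpace ℝ (Fin d) → V), ∫ x, F x ∂μ = ∫ x in Ω, ρ x • F x := by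
    intro V _ _ F
    rw [integral_withDensity_eq_integral_toReal_smul hρmeas.ennreal_ofReal (by simp)]
    simp_rw [ENNReal.toReal_ofReal (hρnn _)]
  have hweakμ : ∀ f : EuclideanSpace ℝ (Fin d) →ᵇ ℝ,
      Tendsto (fun n => ∫ x, f x • Tn n x ∂μ) atTop (𝓝 (∫ x, f x • T x ∂μ)) := by
    intro f
    simp_rw [hμ]
    refine tendsto_integral_smul_of_tendsto_density hρint hρnint hL1 (M := ‖f‖ * C)
      (F := fun n x => f x • Tn n x)
      (fun n => (f.continuous.measurable.smul (hTnmeas n)).aestronglyMeasurable) (fun n => ?_) ?_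
    · filter_upwards [hΩae] with x hx
      rw [norm_smul]
      exact mul_le_mul (f.norm_coe_le_norm x) (hTnbd n x hx) (norm_nonneg _) (norm_nonneg _)
    · simpa only [smul_smul, mul_comm] using
        hweak f f.continuous.continuousOn ⟨‖f‖, fun x _ => f.norm_coe_le_norm x⟩
  have hmomμ : Tendsto (fun n => ∫ x, ‖Tn n x‖ ^ p ∂μ) atTop (𝓝 (∫ x, ‖T x‖ ^ p ∂μ)) := by
    simp_rw [hμ]
    refine tendsto_integral_smul_of_tendsto_density hρint hρnint hL1 (M := C ^ p)
      (fun n => ((hTnmeas n).norm.pow_const p).aestronglyMeasurable) (fun n => ?_) ?_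
    · filter_upwards [hΩae] with x hx
      rw [Real.norm_of_nonneg (by positivity)]
      exact Real.rpow_le_rpow (norm_nonneg _) (hTnbd n x hx) (by linarith)
    · simpa only [smul_eq_mul, mul_comm] using hmom
  have hmain := tendsto_integral_norm_sub_rpow_of_weak (μ := μ) (C := C) hp
    (fun n => (hTnmeas n).aestronglyMeasurable) hTmeas.aestronglyMeasurable
    (fun n => hμae.mono (hTnbd n)) (hμae.mono hTbd) hweakμ hmomμ
  simpa only [hμ, smul_eq_mul, mul_comm] using hmain
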